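/- Brianchon–Gram decomposition: for every (compact, convex) polytope p in ℝ^d, the characteristic function of p equals the sum, over the set F(p) of all faces f of p (including p itself and its vertices), of (−1)^{dim f} times the characteristic function of the affine tangent cone of p at f. -/

import Mathlib

open Classical

noncomputable section

namespace AC

/-- Characteristic function of a set, with values in `ℝ`. -/
def charFn {α : Type*} (s : Set α) (x : α) : ℝ := if x ∈ s then 1 else 0

/-- A face of the polytope `p`: a nonempty subset of the form
`{x ∈ p | ℓ is maximal on p at x}` for some linear form `ℓ`
(this includes `p` itself, via `ℓ = 0`, and the vertices of `p`). -/
def IsFaceOf {d : ℕ} (p f : Set (Fin d → ℝ)) : Prop :=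
  f.Nonempty ∧ ∃ ℓ : (Fin d → ℝ) →ₗ[ℝ] ℝ, f = {x ∈ p | ∀ y ∈ p, ℓ y ≤ ℓ x}

/-- The affine tangent cone of `p` at the face `f`:
`{x + t • (y - x) : x ∈ relint f, y ∈ p, t ≥ 0}`. -/
def affTangentCone {d : ℕ} (p f : Set (Fin d → ℝ)) : Set (Fin d → ℝ) :=
  {z | ∃ x ∈ intrinsicInterior ℝ f, ∃ y ∈ p, ∃ t : ℝ, 0 ≤ t ∧ z = x + t • (y - x)}

/-- A convex set `A` is algebraically relatively open if every segment in `A` can be prolonged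
within `A` beyond its endpoints. -/
def IsRelOpen {V : Type*} [AddCommGroup V] [Module ℝ V] (A : Set V) : Prop :=
  ∀ x ∈ A, ∀ y ∈ A, ∃ ε : ℝ, 0 < ε ∧ x + ε • (x - y) ∈ A

section RelativeInterior

variable {E : Type*} [NormedAddCommGroup E] [NormedSpace ℝ E] {K : Set E} {x y : E}

/-- Near a point `x` of the affine span of `K`, the relative interior of `K` is read off in the
direction space. -/
theorem mem_intrinsicInterior_iff_mem_interior {v : E} (hx : x ∈ K) (hv : v ∈ vectorSpan ℝ K) :
    x + v ∈ intrinsicInterior ℝ K ↔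
      (⟨v, hv⟩ : vectorSpan ℝ K) ∈ interior {w : vectorSpan ℝ K | x + (w : E) ∈ K} := by
  have hd : (affineSpan ℝ K).direction = vectorSpan ℝ K := direction_affineSpan ℝ K
  have hmem : ∀ w : vectorSpan ℝ K, x + (w : E) ∈ affineSpan ℝ K := fun w => by
    have hw : (w : E) ∈ (affineSpan ℝ K).direction := by rw [hd]; exact w.2
    have := AffineSubspace.vadd_mem_of_mem_direction hw (subset_affineSpan ℝ K hx)
    rwa [vadd_eq_add, add_comm] at this
  have hback : ∀ p : affineSpan ℝ K, (p : E) - x ∈ vectorSpan ℝ K := fun p => by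
    have := AffineSubspace.vsub_mem_direction p.2 (subset_affineSpan ℝ K hx)
    rwa [hd] at this
  let e : vectorSpan ℝ K ≃ₜ affineSpan ℝ K :=
    { toFun := fun w => ⟨x + w, hmem w⟩
      invFun := fun p => ⟨p - x, hback p⟩
      left_inv := fun w => by ext; simp
      right_inv := fun p => by ext; simp
      continuous_toFun := by fun_prop
      continuous_invFun := by fun_prop }
  have hpre : {w : vectorSpan ℝ K | x + (w : E) ∈ K} = e ⁻¹' ((↑) ⁻¹' K) := rfl
  rw [hpre, ← e.preimage_interior, mem_intrinsicInterior]
  constructor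
  · rintro ⟨p, hp, hpv⟩
    have : e ⟨v, hv⟩ = p := Subtype.ext hpv.symm
    rwa [Set.mem_preimage, this]
  · intro h
    exact ⟨e ⟨v, hv⟩, h, rfl⟩

/-- A point of a convex set outside its relative interior has a nontrivial supporting
functional. -/
theorem exists_supporting_of_notMem_intrinsicInterior [FiniteDimensional ℝ E] (hK : Convex ℝ K)
    (hx : x ∈ K) (hxi : x ∉ intrinsicInterior ℝ K) :
    ∃ ℓ : E →ₗ[ℝ] ℝ, (∀ y ∈ K, ℓ y ≤ ℓ x) ∧ ∃ y ∈ K, ℓ y < ℓ x := by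
  set W := vectorSpan ℝ K
  set B : Set W := {w : W | x + (w : E) ∈ K} with hB
  have hBc : Convex ℝ B := by
    intro a ha b hb s t hs ht hst
    have := hK ha hb hs ht hst
    have e : x + ((s • a + t • b : W) : E) = s • (x + (a : E)) + t • (x + (b : E)) := by
      have : x = (s + t) • x := by rw [hst, one_smul]
      push_cast
      nth_rewrite 1 [this]
      module
    rwa [hB, Set.mem_ofPred_eq, e]
  have h0 : (0 : W) ∉ interior B := by
    intro h
    apply hxi
    have := (mem_intrinsicInterior_iff_mem_interior hx (zero_mem W)).2 h
    rwa [add_zero] at this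
  have hsub : ∀ y ∈ K, y - x ∈ W := fun y hy => vsub_mem_vectorSpan ℝ hy hx
  obtain ⟨x₁, hx₁⟩ := Set.Nonempty.intrinsicInterior hK ⟨x, hx⟩
  have hx₁K := intrinsicInterior_subset hx₁
  have h1 : (⟨x₁ - x, hsub _ hx₁K⟩ : W) ∈ interior B := by
    refine (mem_intrinsicInterior_iff_mem_interior hx (hsub _ hx₁K)).1 ?_
    rwa [add_sub_cancel]
  obtain ⟨f, hf⟩ := geometric_hahn_banach_open_point hBc.interior isOpen_interior h0
  rw [map_zero] at hf
  obtain ⟨ℓ, hℓ⟩ := LinearMap.exists_extend (f : W →ₗ[ℝ] ℝ)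
  have hval : ∀ y (hy : y ∈ K), ℓ y - ℓ x = f ⟨y - x, hsub y hy⟩ := fun y hy => by
    rw [← map_sub]
    exact LinearMap.congr_fun hℓ ⟨y - x, hsub y hy⟩
  refine ⟨ℓ, fun y hy => ?_, x₁, hx₁K, ?_⟩
  · have hcl : (⟨y - x, hsub y hy⟩ : W) ∈ closure (interior B) := by
      rw [hBc.closure_interior_eq_closure_of_nonempty_interior ⟨_, h1⟩]
      apply subset_closure
      simpa [hB] using hy
    have : f ⟨y - x, hsub y hy⟩ ≤ 0 :=
      closure_minimal (fun w hw => (hf w hw).le)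
        (isClosed_le f.continuous continuous_const) hcl
    linarith [hval y hy]
  · have := hf _ h1
    linarith [hval x₁ hx₁K]

/-- Algebraic description of the relative interior of a convex set. -/
theorem mem_intrinsicInterior_iff_forall_prolong [FiniteDimensional ℝ E] (hK : Convex ℝ K) :
    x ∈ intrinsicInterior ℝ K ↔ x ∈ K ∧ ∀ y ∈ K, ∃ ε : ℝ, 0 < ε ∧ x + ε • (x - y) ∈ K := by
  constructor
  · intro h
    have hx := intrinsicInterior_subset h
    refine ⟨hx, fun y hy => ?_⟩
    have hv : x - y ∈ vectorSpan ℝ K := vsub_mem_vectorSpan ℝ hx hy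
    rw [← add_zero x, mem_intrinsicInterior_iff_mem_interior hx (zero_mem _)] at h
    have hc : Filter.Tendsto (fun ε : ℝ => ε • (⟨x - y, hv⟩ : vectorSpan ℝ K))
        (nhdsWithin 0 (Set.Ioi 0)) (nhds 0) := by
      have : Continuous fun ε : ℝ => ε • (⟨x - y, hv⟩ : vectorSpan ℝ K) := by fun_prop
      have h2 := this.tendsto 0
      rw [zero_smul] at h2
      exact h2.mono_left nhdsWithin_le_nhds
    obtain ⟨ε, hε, hε0⟩ :=
      ((hc.eventually (mem_interior_iff_mem_nhds.1 h)).and self_mem_nhdsWithin).exists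
    exact ⟨ε, hε0, hε⟩
  · rintro ⟨hx, h⟩
    by_contra hxi
    obtain ⟨ℓ, hℓ, y, hy, hlt⟩ := exists_supporting_of_notMem_intrinsicInterior hK hx hxi
    obtain ⟨ε, hε, hmem⟩ := h y hy
    have := hℓ _ hmem
    simp only [map_add, map_smul, map_sub, smul_eq_mul] at this
    nlinarith [mul_pos hε (sub_pos.2 hlt)]

theorem combo_mem_intrinsicInterior [FiniteDimensional ℝ E] (hK : Convex ℝ K)
    (hx : x ∈ intrinsicInterior ℝ K) (hy : y ∈ K) {s t : ℝ} (hs : 0 < s) (ht : 0 ≤ t)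
    (hst : s + t = 1) : s • x + t • y ∈ intrinsicInterior ℝ K := by
  obtain ⟨hxK, hxp⟩ := (mem_intrinsicInterior_iff_forall_prolong hK).1 hx
  refine (mem_intrinsicInterior_iff_forall_prolong hK).2
    ⟨hK hxK hy hs.le ht hst, fun z hz => ?_⟩
  obtain ⟨ε, hε, hmem⟩ := hxp z hz
  have hD : 0 < 1 + ε * t := by positivity
  refine ⟨s * ε / (1 + ε * t), by positivity, ?_⟩
  have := hK hmem hy (a := s / (1 + ε * t)) (b := (1 + ε) * t / (1 + ε * t)) (by positivity)
    (by positivity) (by field_simp; linear_combination hst)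
  convert this using 1
  have hs' : s = 1 - t := by linarith
  subst hs'
  match_scalars <;> field_simp <;> ring

theorem convex_intrinsicInterior [FiniteDimensional ℝ E] (hK : Convex ℝ K) :
    Convex ℝ (intrinsicInterior ℝ K) := by
  intro x hx y hy s t hs ht hst
  rcases hs.eq_or_lt with rfl | hs
  · rw [zero_add] at hst
    simpa [hst] using hy
  · exact combo_mem_intrinsicInterior hK hx (intrinsicInterior_subset hy) hs ht hst

theorem isRelOpen_intrinsicInterior [FiniteDimensional ℝ E] (hK : Convex ℝ K) :
    IsRelOpen (intrinsicInterior ℝ K) := by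
  intro x hx y hy
  obtain ⟨ε, hε, hmem⟩ :=
    ((mem_intrinsicInterior_iff_forall_prolong hK).1 hx).2 y (intrinsicInterior_subset hy)
  refine ⟨ε / 2, by positivity, ?_⟩
  convert combo_mem_intrinsicInterior hK hx hmem (s := 1 / 2) (t := 1 / 2) (by norm_num)
    (by norm_num) (by norm_num) using 1
  module

theorem vectorSpan_intrinsicInterior [FiniteDimensional ℝ E] (hK : Convex ℝ K) :
    vectorSpan ℝ (intrinsicInterior ℝ K) = vectorSpan ℝ K := by
  refine le_antisymm (vectorSpan_mono ℝ intrinsicInterior_subset) ?_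
  rcases K.eq_empty_or_nonempty with rfl | hne
  · simp
  obtain ⟨x, hx⟩ := Set.Nonempty.intrinsicInterior hK hne
  rw [vectorSpan_eq_span_vsub_set_right ℝ (intrinsicInterior_subset hx), Submodule.span_le]
  rintro _ ⟨y, hy, rfl⟩
  have hm := combo_mem_intrinsicInterior hK hx hy (s := 1 / 2) (t := 1 / 2) (by norm_num)
    (by norm_num) (by norm_num)
  have := Submodule.smul_mem _ (2 : ℝ) (vsub_mem_vectorSpan ℝ hm hx)
  have e : y -ᵥ x = (2 : ℝ) • (((1 / 2 : ℝ) • x + (1 / 2 : ℝ) • y) -ᵥ x) := by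
    simp only [vsub_eq_sub]
    module
  exact (congrArg (· ∈ vectorSpan ℝ (intrinsicInterior ℝ K)) e).mpr this

end RelativeInterior

section EulerCharacteristic

open Filter Topology

theorem charFn_of_mem {α : Type*} {s : Set α} {x : α} (h : x ∈ s) : charFn s x = 1 := if_pos h

theorem charFn_of_notMem {α : Type*} {s : Set α} {x : α} (h : x ∉ s) : charFn s x = 0 := if_neg h

/-- The right jumps of the characteristic function of a relatively open interval, together with its
limit at `-∞`, determine the Euler characteristic of the interval. -/
theorem exists_rightJump {B : Set ℝ} (hB : Convex ℝ B) (ho : IsRelOpen B) (hne : B.Nonempty) :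
    ∃ (J : ℝ →₀ ℝ) (m : ℝ),
      (∀ t, ∀ᶠ s in 𝓝[>] t, charFn B t - charFn B s = J t) ∧
      (∀ᶠ s in atBot, charFn B s = m) ∧
      (J.sum fun _ v => v) - m = if B.Subsingleton then 1 else -1 := by
  by_cases hs : B.Subsingleton
  · obtain ⟨a, ha⟩ := hne
    obtain rfl : B = {a} := hs.eq_singleton_of_mem ha
    refine ⟨Finsupp.single a 1, 0, fun t => ?_, ?_, by simp⟩
    · rcases lt_trichotomy t a with h | rfl | h
      · filter_upwards [Ioo_mem_nhdsGT h] with s hs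
        rw [charFn_of_notMem (by simpa using h.ne), charFn_of_notMem (by simpa using hs.2.ne),
          Finsupp.single_eq_of_ne h.ne, sub_zero]
      · filter_upwards [self_mem_nhdsWithin] with s hs
        rw [charFn_of_mem (by simp), charFn_of_notMem (by simpa using (Set.mem_Ioi.1 hs).ne'),
          Finsupp.single_eq_same, sub_zero]
      · filter_upwards [self_mem_nhdsWithin] with s hs
        rw [charFn_of_notMem (by simpa using h.ne'),
          charFn_of_notMem (by simpa using (h.trans hs).ne'),
          Finsupp.single_eq_of_ne h.ne', sub_zero]
    · filter_upwards [eventually_lt_atBot a] with s hs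
      exact charFn_of_notMem (by simpa using hs.ne)
  have hoc := hB.ordConnected
  have hex : ∀ t ∈ B, (∃ s ∈ B, t < s) ∧ ∃ s ∈ B, s < t := by
    intro t ht
    obtain ⟨y, hy, hyt⟩ := (Set.not_subsingleton_iff.1 hs).exists_ne t
    obtain ⟨ε, hε, hmem⟩ := ho t ht y hy
    rw [smul_eq_mul] at hmem
    rcases lt_or_gt_of_ne hyt with h | h
    · exact ⟨⟨_, hmem, by nlinarith⟩, y, hy, h⟩
    · exact ⟨⟨y, hy, h⟩, _, hmem, by nlinarith⟩
  have hin : ∀ t ∈ B, ∀ᶠ s in 𝓝[>] t, charFn B t - charFn B s = 0 := by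
    intro t ht
    obtain ⟨⟨u, hu, htu⟩, -⟩ := hex t ht
    filter_upwards [Ioo_mem_nhdsGT htu] with s hs
    rw [charFn_of_mem ht, charFn_of_mem (hoc.out ht hu ⟨hs.1.le, hs.2.le⟩), sub_self]
  have habove : ∀ t ∉ B, (∀ s ∈ B, s ≤ t) → ∀ᶠ s in 𝓝[>] t, charFn B t - charFn B s = 0 := by
    intro t ht hle
    filter_upwards [self_mem_nhdsWithin] with s hs
    rw [charFn_of_notMem ht, charFn_of_notMem fun h => (hle s h).not_gt hs, sub_self]
  have hlower : ∀ t ∉ B, (∃ s ∈ B, t < s) → ∀ b ∈ B, t < b := by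
    rintro t ht ⟨s, hs, hts⟩ b hb
    by_contra! hbt
    exact ht (hoc.out hb hs ⟨hbt, hts.le⟩)
  rw [if_neg hs]
  by_cases hbdd : BddBelow B
  · have hlt : ∀ b ∈ B, sInf B < b := fun b hb => by
      obtain ⟨-, u, hu, hub⟩ := hex b hb
      exact (csInf_le hbdd hu).trans_lt hub
    have hnot : sInf B ∉ B := fun h => lt_irrefl _ (hlt _ h)
    refine ⟨Finsupp.single (sInf B) (-1), 0, fun t => ?_, ?_,
      by rw [Finsupp.sum_single_index rfl, sub_zero]⟩
    · by_cases htB : t ∈ B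
      · rw [Finsupp.single_eq_of_ne (hlt t htB).ne']
        exact hin t htB
      rcases lt_trichotomy t (sInf B) with h | rfl | h
      · filter_upwards [Ioo_mem_nhdsGT h] with s hs
        rw [charFn_of_notMem htB, charFn_of_notMem fun hsB => lt_asymm hs.2 (hlt s hsB),
          Finsupp.single_eq_of_ne h.ne, sub_zero]
      · obtain ⟨b, hb⟩ := hne
        filter_upwards [Ioo_mem_nhdsGT (hlt b hb)] with s hs
        obtain ⟨u, hu, hus⟩ := exists_lt_of_csInf_lt ⟨b, hb⟩ hs.1
        rw [charFn_of_notMem htB, charFn_of_mem (hoc.out hu hb ⟨hus.le, hs.2.le⟩),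
          Finsupp.single_eq_same, zero_sub]
      · rw [Finsupp.single_eq_of_ne h.ne']
        refine habove t htB fun s hs => ?_
        by_contra! hts
        exact h.not_ge (le_csInf hne fun b hb => (hlower t htB ⟨s, hs, hts⟩ b hb).le)
    · filter_upwards [eventually_lt_atBot (sInf B)] with s hs
      exact charFn_of_notMem fun hsB => lt_asymm hs (hlt s hsB)
  · refine ⟨0, 1, fun t => ?_, ?_, by simp⟩
    · by_cases htB : t ∈ B
      · exact hin t htB
      · refine habove t htB fun s hs => ?_
        by_contra! hts
        exact hbdd ⟨t, fun b hb => (hlower t htB ⟨s, hs, hts⟩ b hb).le⟩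
    · obtain ⟨b, hb⟩ := hne
      filter_upwards [eventually_lt_atBot b] with s hs
      rw [not_bddBelow_iff] at hbdd
      obtain ⟨u, hu, hus⟩ := hbdd s
      exact charFn_of_mem (hoc.out hu hb ⟨hus.le, hs.le⟩)

/-- If a combination of relatively open intervals is right-continuous and vanishes near `-∞`, then
the corresponding combination of Euler characteristics vanishes. -/
theorem sum_eulerChar_real_eq_zero {ι : Type*} (I : Finset ι) (c : ι → ℝ) (B : ι → Set ℝ)
    (hconv : ∀ i ∈ I, Convex ℝ (B i)) (ho : ∀ i ∈ I, IsRelOpen (B i))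
    (hne : ∀ i ∈ I, (B i).Nonempty)
    (hright : ∀ t, ∀ᶠ s in 𝓝[>] t,
      ∑ i ∈ I, c i * charFn (B i) t = ∑ i ∈ I, c i * charFn (B i) s)
    (hbot : ∀ᶠ s in atBot, ∑ i ∈ I, c i * charFn (B i) s = 0) :
    ∑ i ∈ I, c i * (if (B i).Subsingleton then 1 else -1) = 0 := by
  have hdata : ∀ i : I, _ := fun i => exists_rightJump (hconv i i.2) (ho i i.2) (hne i i.2)
  choose J m hJ hm hsum using hdata
  have hJ0 : ∑ i : I, c i • J i = 0 := by
    ext t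
    obtain ⟨s, hs, hs'⟩ := ((eventually_all.2 fun i : I => hJ i t).and (hright t)).exists
    simp only [Finsupp.coe_finsetSum, Finset.sum_apply, Finsupp.smul_apply, smul_eq_mul,
      Finsupp.zero_apply]
    rw [← Finset.sum_coe_sort I, ← Finset.sum_coe_sort I] at hs'
    simp only [← hs, mul_sub, Finset.sum_sub_distrib, hs', sub_self]
  have hm0 : ∑ i : I, c i * m i = 0 := by
    obtain ⟨s, hs, hs'⟩ := ((eventually_all.2 fun i : I => hm i).and hbot).exists
    rw [← Finset.sum_coe_sort I] at hs'
    simpa only [hs] using hs'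
  rw [← Finset.sum_coe_sort I]
  let L : (ℝ →₀ ℝ) →ₗ[ℝ] ℝ := Finsupp.lsum ℝ fun _ => LinearMap.id
  have hL : ∀ i : I, L (J i) = (J i).sum fun _ v => v := fun i => rfl
  have h0 := congrArg L hJ0
  simp only [map_sum, map_smul, map_zero, smul_eq_mul, hL] at h0
  simp only [← hsum, mul_sub, Finset.sum_sub_distrib, h0, hm0, sub_self]

variable {V : Type*} [AddCommGroup V] [Module ℝ V]

theorem IsRelOpen.exists_add_smul_mem {A : Set V} (hA : Convex ℝ A) (ho : IsRelOpen A) {x u : V}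
    (hx : x ∈ A) (hu : u ∈ vectorSpan ℝ A) : ∃ ε : ℝ, 0 < ε ∧ x + ε • u ∈ A := by
  rw [vectorSpan_eq_span_vsub_set_right ℝ hx] at hu
  induction hu using Submodule.span_induction with
  | mem u hu =>
    obtain ⟨y, hy, rfl⟩ := hu
    exact ⟨1, one_pos, by simpa using hy⟩
  | zero => exact ⟨1, one_pos, by simpa using hx⟩
  | add u v _ _ hu hv =>
    obtain ⟨ε, hε, hεm⟩ := hu
    obtain ⟨δ, hδ, hδm⟩ := hv
    refine ⟨ε * δ / (ε + δ), by positivity, ?_⟩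
    convert hA hεm hδm (a := δ / (ε + δ)) (b := ε / (ε + δ)) (by positivity) (by positivity)
      (by field_simp; ring) using 1
    match_scalars <;> field_simp
    ring
  | smul r u _ hu =>
    obtain ⟨ε, hε, hεm⟩ := hu
    rcases lt_trichotomy r 0 with hr | rfl | hr
    · obtain ⟨δ, hδ, hδm⟩ := ho x hx _ hεm
      refine ⟨δ * ε / -r, div_pos (by positivity) (by linarith), ?_⟩
      convert hδm using 1
      have := hr.ne
      match_scalars <;> field_simp
      ring
    · exact ⟨1, one_pos, by simpa using hx⟩
    · refine ⟨ε / r, by positivity, ?_⟩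
      rwa [smul_smul, div_mul_cancel₀ _ hr.ne']

theorem neg_one_pow_finrank_map_mkQ [FiniteDimensional ℝ V] (W : Submodule ℝ V) {w : V}
    (hw : w ≠ 0) :
    (if w ∈ W then -1 else 1) * (-1 : ℝ) ^ Module.finrank ℝ (W.map (ℝ ∙ w).mkQ) =
      (-1) ^ Module.finrank ℝ W := by
  have hrn := LinearMap.finrank_range_add_finrank_ker ((ℝ ∙ w).mkQ.domRestrict W)
  rw [LinearMap.range_domRestrict] at hrn
  split_ifs with h
  · have hk : LinearMap.ker ((ℝ ∙ w).mkQ.domRestrict W) = ℝ ∙ (⟨w, h⟩ : W) := by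
      ext x
      simp [Submodule.mem_span_singleton, Subtype.ext_iff]
    rw [hk, finrank_span_singleton (by simpa [Subtype.ext_iff] using hw)] at hrn
    rw [← hrn, pow_succ]
    ring
  · have hk : LinearMap.ker ((ℝ ∙ w).mkQ.domRestrict W) = ⊥ := by
      rw [Submodule.eq_bot_iff]
      rintro ⟨x, hx⟩ hx0
      simp only [LinearMap.mem_ker, LinearMap.domRestrict_apply, Submodule.mkQ_apply,
        Submodule.Quotient.mk_eq_zero, Submodule.mem_span_singleton] at hx0
      obtain ⟨a, rfl⟩ := hx0
      rcases eq_or_ne a 0 with rfl | ha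
      · simp
      · exact absurd ((W.smul_mem_iff ha).1 hx) h
    rw [hk, finrank_bot, add_zero] at hrn
    rw [one_mul, hrn]

/-- Fubini step: relations between relatively open convex sets that hold along all lines of a fixed
direction follow from relations between their projections along that direction. -/
theorem sum_eulerChar_eq_zero_of_lines [FiniteDimensional ℝ V] {ι : Type*} {w : V} (hw : w ≠ 0)
    (ih : ∀ (I : Finset ι) (c : ι → ℝ) (A : ι → Set (V ⧸ ℝ ∙ w)), (∀ i ∈ I, Convex ℝ (A i)) →
      (∀ i ∈ I, IsRelOpen (A i)) → (∀ i ∈ I, (A i).Nonempty) →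
      (∀ x, ∑ i ∈ I, c i * charFn (A i) x = 0) →
      ∑ i ∈ I, c i * (-1 : ℝ) ^ Module.finrank ℝ (vectorSpan ℝ (A i)) = 0)
    (I : Finset ι) (c : ι → ℝ) (A : ι → Set V) (hconv : ∀ i ∈ I, Convex ℝ (A i))
    (ho : ∀ i ∈ I, IsRelOpen (A i)) (hne : ∀ i ∈ I, (A i).Nonempty)
    (hright : ∀ (v : V) (t : ℝ), ∀ᶠ s in 𝓝[>] t,
      ∑ i ∈ I, c i * charFn (A i) (v + t • w) = ∑ i ∈ I, c i * charFn (A i) (v + s • w))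
    (hbot : ∀ v : V, ∀ᶠ s : ℝ in atBot, ∑ i ∈ I, c i * charFn (A i) (v + s • w) = 0) :
    ∑ i ∈ I, c i * (-1 : ℝ) ^ Module.finrank ℝ (vectorSpan ℝ (A i)) = 0 := by
  have key := ih I (fun i => c i * if w ∈ vectorSpan ℝ (A i) then -1 else 1)
    (fun i => (ℝ ∙ w).mkQ '' A i) (fun i hi => (hconv i hi).linear_image _) ?_
    (fun i hi => (hne i hi).image _) ?_
  · rw [← key]
    refine Finset.sum_congr rfl fun i hi => ?_
    have : vectorSpan ℝ ((ℝ ∙ w).mkQ '' A i) = (vectorSpan ℝ (A i)).map (ℝ ∙ w).mkQ :=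
      ((ℝ ∙ w).mkQ.toAffineMap.map_vectorSpan).symm
    rw [this, mul_assoc, neg_one_pow_finrank_map_mkQ _ hw]
  · rintro i hi _ ⟨x, hx, rfl⟩ _ ⟨y, hy, rfl⟩
    obtain ⟨ε, hε, hm⟩ := ho i hi x hx y hy
    exact ⟨ε, hε, _, hm, by simp⟩
  · intro x
    obtain ⟨v, rfl⟩ := Submodule.mkQ_surjective _ x
    set B : ι → Set ℝ := fun i => {s | v + s • w ∈ A i} with hB
    have hBA : ∀ i s, charFn (A i) (v + s • w) = charFn (B i) s := fun i s => rfl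
    have hpi : ∀ i, (ℝ ∙ w).mkQ v ∈ (ℝ ∙ w).mkQ '' A i ↔ (B i).Nonempty := by
      intro i
      constructor
      · rintro ⟨y, hy, hyv⟩
        rw [← sub_eq_zero, ← map_sub, Submodule.mkQ_apply, Submodule.Quotient.mk_eq_zero,
          Submodule.mem_span_singleton] at hyv
        obtain ⟨a, ha⟩ := hyv
        refine ⟨a, ?_⟩
        rw [hB, Set.mem_ofPred_eq, ha]
        simpa using hy
      · rintro ⟨s, hs⟩
        refine ⟨_, hs, ?_⟩
        have : (ℝ ∙ w).mkQ w = 0 := by simp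
        rw [map_add, map_smul, this, smul_zero, add_zero]
    have hBsub : ∀ i ∈ I, (B i).Nonempty →
        ((B i).Subsingleton ↔ w ∉ vectorSpan ℝ (A i)) := by
      rintro i hi ⟨s, hs⟩
      constructor
      · intro hsub hwA
        obtain ⟨ε, hε, hm⟩ := (ho i hi).exists_add_smul_mem (hconv i hi) hs hwA
        rw [add_assoc, ← add_smul] at hm
        linarith [hsub hs hm]
      · intro hwA a ha b hb
        by_contra hab
        apply hwA
        have := vsub_mem_vectorSpan ℝ (s := A i) ha hb
        rw [vsub_eq_sub, add_sub_add_left_eq_sub, ← sub_smul] at this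
        exact (Submodule.smul_mem_iff _ (sub_ne_zero.2 hab)).1 this
    have hfilter : ∀ s, ∑ i ∈ I, c i * charFn (A i) (v + s • w) =
        ∑ i ∈ I with (B i).Nonempty, c i * charFn (B i) s := by
      intro s
      rw [Finset.sum_filter]
      refine Finset.sum_congr rfl fun i _ => ?_
      split_ifs with h
      · rfl
      · rw [hBA, charFn_of_notMem fun hs => h ⟨s, hs⟩, mul_zero]
    have h1 := sum_eulerChar_real_eq_zero (I.filter fun i => (B i).Nonempty) c B ?_ ?_ ?_ ?_ ?_
    · rw [Finset.sum_filter] at h1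
      rw [← h1]
      refine Finset.sum_congr rfl fun i hi => ?_
      split_ifs with h2 h3 h4 h4 h4
      all_goals first
        | rw [charFn_of_notMem (mt (hpi i).1 ‹_›), mul_zero]
        | (have := hBsub i hi ‹_›
           rw [charFn_of_mem ((hpi i).2 ‹_›)]
           first
             | tauto
             | ring)
    · intro i hi a ha b hb p q hp hq hpq
      have := hconv i (Finset.mem_filter.1 hi).1 ha hb hp hq hpq
      have e : v + (p • a + q • b) • w = p • (v + a • w) + q • (v + b • w) := by
        have : v = (p + q) • v := by rw [hpq, one_smul]
        nth_rewrite 1 [this]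
        simp only [smul_eq_mul]
        module
      rwa [hB, Set.mem_ofPred_eq, e]
    · intro i hi a ha b hb
      obtain ⟨ε, hε, hm⟩ := ho i (Finset.mem_filter.1 hi).1 _ ha _ hb
      refine ⟨ε, hε, ?_⟩
      rw [hB, Set.mem_ofPred_eq]
      convert hm using 1
      simp only [smul_eq_mul]
      module
    · exact fun i hi => (Finset.mem_filter.1 hi).2
    · intro t
      simpa only [hfilter] using hright v t
    · simpa only [hfilter] using hbot v

/-- The Euler characteristic `A ↦ (-1) ^ dim A` of relatively open convex sets respects linear
relations between characteristic functions. -/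
theorem sum_eulerChar_eq_zero [FiniteDimensional ℝ V] {ι : Type*} (I : Finset ι) (c : ι → ℝ)
    (A : ι → Set V) (hconv : ∀ i ∈ I, Convex ℝ (A i)) (ho : ∀ i ∈ I, IsRelOpen (A i))
    (hne : ∀ i ∈ I, (A i).Nonempty) (h : ∀ x, ∑ i ∈ I, c i * charFn (A i) x = 0) :
    ∑ i ∈ I, c i * (-1 : ℝ) ^ Module.finrank ℝ (vectorSpan ℝ (A i)) = 0 := by
  induction hn : Module.finrank ℝ V generalizing V I c with
  | zero =>
    have := Module.finrank_zero_iff.1 hn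
    rw [← h 0]
    refine Finset.sum_congr rfl fun i hi => ?_
    obtain ⟨x, hx⟩ := hne i hi
    rw [Subsingleton.elim 0 x, charFn_of_mem hx, Module.finrank_zero_of_subsingleton, pow_zero]
  | succ n ih =>
    have : Nontrivial V := Module.nontrivial_of_finrank_pos (R := ℝ) (by omega)
    obtain ⟨w, hw⟩ := exists_ne (0 : V)
    have hq : Module.finrank ℝ (V ⧸ ℝ ∙ w) = n := by
      have := Submodule.finrank_quotient_add_finrank (ℝ ∙ w)
      rw [finrank_span_singleton hw] at this
      omega
    exact sum_eulerChar_eq_zero_of_lines hw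
      (fun I c A h1 h2 h3 h4 => ih I c A h1 h2 h3 h4 hq) I c A hconv ho hne
      (fun v t => by simp [h]) (fun v => by simp [h])

end EulerCharacteristic

section ConeOver

open Filter Topology

/-- The open cone over `A`, placed at height `1`. -/
def coneOver {E : Type*} [AddCommGroup E] [Module ℝ E] (A : Set E) : Set (E × ℝ) :=
  {v | 0 < v.2 ∧ ∃ x ∈ A, v.1 = v.2 • x}

/-- The cone over `A`, placed at height `1`, together with its apex. -/
def closedConeOver {E : Type*} [AddCommGroup E] [Module ℝ E] (A : Set E) : Set (E × ℝ) :=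
  {v | 0 ≤ v.2 ∧ ∃ x ∈ A, v.1 = v.2 • x}

/-- The points of `A` from which one can move a little in direction `w` without leaving `A`. -/
def prolongable {V : Type*} [AddCommGroup V] [Module ℝ V] (A : Set V) (w : V) : Set V :=
  {v | v ∈ A ∧ ∃ ε : ℝ, 0 < ε ∧ v + ε • w ∈ A}

section Algebra

variable {E : Type*} [AddCommGroup E] [Module ℝ E] {A : Set E}

theorem convex_coneOver (hA : Convex ℝ A) : Convex ℝ (coneOver A) := by
  rintro ⟨u, r⟩ ⟨hr, x, hx, (rfl : u = r • x)⟩ ⟨v, s⟩ ⟨hs, y, hy, (rfl : v = s • y)⟩ p q hp hq hpq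
  simp only at hr hs
  obtain ⟨z, hz, e⟩ := hA.exists_mem_add_smul_eq hx hy (mul_nonneg hp hr.le) (mul_nonneg hq hs.le)
  have hpos : 0 < p * r + q * s := by
    rcases hp.eq_or_lt with rfl | hp
    · obtain rfl : q = 1 := by linarith
      simpa using hs
    · have := mul_pos hp hr
      have := mul_nonneg hq hs.le
      linarith
  exact ⟨hpos, z, hz, by simp [smul_smul, e]⟩

theorem convex_closedConeOver (hA : Convex ℝ A) : Convex ℝ (closedConeOver A) := by
  rintro ⟨u, r⟩ ⟨hr, x, hx, (rfl : u = r • x)⟩ ⟨v, s⟩ ⟨hs, y, hy, (rfl : v = s • y)⟩ p q hp hq hpq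
  obtain ⟨z, hz, e⟩ := hA.exists_mem_add_smul_eq hx hy (mul_nonneg hp hr) (mul_nonneg hq hs)
  exact ⟨add_nonneg (mul_nonneg hp hr) (mul_nonneg hq hs), z, hz, by simp [smul_smul, e]⟩

theorem isRelOpen_coneOver (hc : Convex ℝ A) (hA : IsRelOpen A) : IsRelOpen (coneOver A) := by
  rintro ⟨u, r⟩ ⟨hr, x, hx, (rfl : u = r • x)⟩ ⟨v, s⟩ ⟨hs, y, hy, (rfl : v = s • y)⟩
  simp only at hr hs
  obtain ⟨ε, hε, hm⟩ := hA x hx y hy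
  have hk : 0 < s + ε * r := by positivity
  have hbase : x + (ε * s / (s + ε * r)) • (x - y) ∈ A := by
    convert hc hm hx (a := s / (s + ε * r)) (b := ε * r / (s + ε * r)) (by positivity)
      (by positivity) (by field_simp) using 1
    match_scalars <;> field_simp <;> ring
  have e : r + ε * r / (s * (1 + ε)) * (r - s) = r * (s + ε * r) / (s * (1 + ε)) := by
    field_simp
    ring
  refine ⟨ε * r / (s * (1 + ε)), by positivity, ?_, _, hbase, ?_⟩
  · simp only [Prod.snd_add, Prod.smul_snd, Prod.snd_sub, smul_eq_mul]
    rw [e]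
    positivity
  · simp only [Prod.snd_add, Prod.smul_snd, Prod.snd_sub, smul_eq_mul, Prod.fst_add,
      Prod.smul_fst, Prod.fst_sub]
    rw [e]
    match_scalars <;> field_simp <;> ring

theorem finrank_vectorSpan_coneOver [FiniteDimensional ℝ E] (hne : A.Nonempty) :
    Module.finrank ℝ (vectorSpan ℝ (coneOver A)) = Module.finrank ℝ (vectorSpan ℝ A) + 1 := by
  obtain ⟨x₀, hx₀⟩ := hne
  let L : (vectorSpan ℝ A × ℝ) →ₗ[ℝ] E × ℝ :=
    ((vectorSpan ℝ A).subtype.coprod (LinearMap.toSpanSingleton ℝ E x₀)).prod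
      (LinearMap.snd ℝ _ ℝ)
  have hL : ∀ u r, L (u, r) = ((u : E) + r • x₀, r) := fun u r => rfl
  have hinj : Function.Injective L := by
    rintro ⟨u, r⟩ ⟨u', r'⟩ h
    rw [hL, hL, Prod.mk.injEq] at h
    obtain ⟨h1, rfl⟩ := h
    rw [Prod.mk.injEq]
    exact ⟨Subtype.ext (add_right_cancel h1), rfl⟩
  have h1 : ((x₀, 1) : E × ℝ) ∈ coneOver A := ⟨one_pos, x₀, hx₀, (one_smul ℝ _).symm⟩
  have hrange : vectorSpan ℝ (coneOver A) = LinearMap.range L := by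
    apply le_antisymm
    · rw [vectorSpan_def, Submodule.span_le]
      rintro _ ⟨⟨u, r⟩, ⟨-, x, hx, (rfl : u = r • x)⟩,
        ⟨v, s⟩, ⟨-, y, hy, (rfl : v = s • y)⟩, rfl⟩
      refine ⟨(r • ⟨x - x₀, vsub_mem_vectorSpan ℝ hx hx₀⟩ -
        s • ⟨y - x₀, vsub_mem_vectorSpan ℝ hy hx₀⟩, r - s), ?_⟩
      rw [hL]
      simp only [vsub_eq_sub, Prod.mk_sub_mk, Prod.mk.injEq, and_true]
      push_cast
      module
    · rintro _ ⟨⟨⟨u, hu⟩, r⟩, rfl⟩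
      have e : L (⟨u, hu⟩, r) = LinearMap.inl ℝ E ℝ u + r • ((x₀, 1) : E × ℝ) := by
        rw [hL]
        simp
      rw [e]
      refine add_mem ?_ (Submodule.smul_mem _ _ ?_)
      · rw [vectorSpan_eq_span_vsub_set_right ℝ hx₀] at hu
        refine (Submodule.span_le (p := (vectorSpan ℝ (coneOver A)).comap
          (LinearMap.inl ℝ E ℝ))).2 ?_ hu
        rintro _ ⟨x, hx, rfl⟩
        have h2 : ((x, 1) : E × ℝ) ∈ coneOver A := ⟨one_pos, x, hx, (one_smul ℝ _).symm⟩
        have := vsub_mem_vectorSpan ℝ h2 h1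
        simpa using this
      · have h2 : (((2 : ℝ) • x₀, 2) : E × ℝ) ∈ coneOver A := ⟨two_pos, x₀, hx₀, rfl⟩
        have := vsub_mem_vectorSpan ℝ h2 h1
        have e2 : (((2 : ℝ) • x₀, 2) : E × ℝ) -ᵥ (x₀, 1) = (x₀, 1) := by
          rw [vsub_eq_sub, Prod.mk_sub_mk, two_smul, add_sub_cancel_right]
          norm_num
        rwa [e2] at this
  rw [hrange, LinearMap.finrank_range_of_inj hinj, Module.finrank_prod, Module.finrank_self]

/-- Prolonging a point of a cone in direction `(z, 1)` amounts to moving its base point towards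
`z`. -/
theorem smul_mem_prolongable_closedConeOver (hA : Convex ℝ A) {x z : E} (hx : x ∈ A) {r : ℝ}
    (hr : 0 < r) :
    (r • x, r) ∈ prolongable (closedConeOver A) (z, (1 : ℝ)) ↔
      ∃ ε : ℝ, 0 < ε ∧ x + ε • (z - x) ∈ A := by
  constructor
  · rintro ⟨-, ε, hε, -, y, hy, h⟩
    simp only [Prod.smul_mk, Prod.mk_add_mk, smul_eq_mul, mul_one] at h
    refine ⟨ε / (r + ε), by positivity, ?_⟩
    have hy' : y = (r + ε)⁻¹ • (r • x + ε • z) := by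
      rw [h, inv_smul_smul₀ (by positivity)]
    convert hy using 1
    rw [hy']
    match_scalars <;> field_simp
    ring
  · rintro ⟨ε, hε, hm⟩
    refine ⟨⟨hr.le, x, hx, rfl⟩, r * ε, by positivity, by simp; positivity, x + (ε / (1 + ε)) •
      (z - x), ?_, ?_⟩
    · convert hA hx hm (a := ε / (1 + ε)) (b := 1 / (1 + ε)) (by positivity) (by positivity)
        (by field_simp; ring) using 1
      match_scalars <;> field_simp <;> ring
    · simp only [Prod.smul_mk, Prod.mk_add_mk, smul_eq_mul, mul_one]
      match_scalars <;> field_simp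
      ring

theorem zero_mem_prolongable_closedConeOver (hne : A.Nonempty) {z : E} :
    (0 : E × ℝ) ∈ prolongable (closedConeOver A) (z, (1 : ℝ)) ↔ z ∈ A := by
  constructor
  · rintro ⟨-, ε, hε, -, y, hy, h⟩
    simp only [Prod.smul_mk, zero_add, smul_eq_mul, mul_one] at h
    rwa [smul_right_injective E hε.ne' h]
  · intro hz
    obtain ⟨x, hx⟩ := hne
    refine ⟨⟨le_rfl, x, hx, by simp⟩, 1, one_pos, ?_, z, hz, ?_⟩ <;> simp

theorem eventually_atBot_notMem_closedConeOver (z : E) (v : E × ℝ) :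
    ∀ᶠ s : ℝ in atBot, v + s • ((z, 1) : E × ℝ) ∉ closedConeOver A := by
  filter_upwards [eventually_lt_atBot (-v.2)] with s hs hm
  have := hm.1
  simp only [Prod.snd_add, Prod.smul_snd, smul_eq_mul, mul_one] at this
  linarith

end Algebra

theorem isClosed_closedConeOver {E : Type*} [NormedAddCommGroup E] [NormedSpace ℝ E] {A : Set E}
    (hA : IsCompact A) : IsClosed (closedConeOver A) := by
  have hM : ∀ M : ℝ, IsClosed {v : E × ℝ | v ∈ closedConeOver A ∧ v.2 ≤ M} := by
    intro M
    have himage : {v : E × ℝ | v ∈ closedConeOver A ∧ v.2 ≤ M} =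
        (fun q : E × ℝ => (q.2 • q.1, q.2)) '' (A ×ˢ Set.Icc 0 M) := by
      ext ⟨y, r⟩
      constructor
      · rintro ⟨⟨hr, x, hx, hy⟩, hrM⟩
        exact ⟨(x, r), ⟨hx, hr, hrM⟩, Prod.ext hy.symm rfl⟩
      · rintro ⟨⟨x, r'⟩, ⟨hx, hr, hrM⟩, h⟩
        obtain ⟨rfl, rfl⟩ := Prod.ext_iff.1 h
        exact ⟨⟨hr, x, hx, rfl⟩, hrM⟩
    rw [himage]
    exact ((hA.prod isCompact_Icc).image (by fun_prop)).isClosed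
  rw [← isOpen_compl_iff, isOpen_iff_mem_nhds]
  intro v hv
  have hlt : ∀ᶠ u : E × ℝ in 𝓝 v, u.2 < v.2 + 1 :=
    continuous_snd.continuousAt.eventually_lt continuousAt_const (lt_add_one _)
  filter_upwards [(hM (v.2 + 1)).isOpen_compl.mem_nhds fun h => hv h.1, hlt] with u hu hu2 hmem
  exact hu ⟨hmem, le_of_lt hu2⟩

/-- Along lines of direction `w`, the characteristic function of `prolongable A w` is
right-continuous if `A` is closed and convex. -/
theorem eventually_charFn_prolongable_eq {V : Type*} [NormedAddCommGroup V] [NormedSpace ℝ V]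
    {A : Set V} (hA : Convex ℝ A) (hcl : IsClosed A) (v w : V) (t : ℝ) :
    ∀ᶠ s in 𝓝[>] t,
      charFn (prolongable A w) (v + t • w) = charFn (prolongable A w) (v + s • w) := by
  have hseg : ∀ {a b s : ℝ}, v + a • w ∈ A → v + b • w ∈ A → a ≤ s → s ≤ b → v + s • w ∈ A := by
    intro a b s ha hb has hsb
    have hconv : Convex ℝ ((AffineMap.lineMap v (v + w) : ℝ →ᵃ[ℝ] V) ⁻¹' A) :=
      hA.affine_preimage _
    have hmem : ∀ r : ℝ, r ∈ ((AffineMap.lineMap v (v + w) : ℝ →ᵃ[ℝ] V) ⁻¹' A) ↔ v + r • w ∈ A := by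
      intro r
      simp [AffineMap.lineMap_apply, add_comm]
    exact (hmem s).1 (hconv.ordConnected.out ((hmem a).2 ha) ((hmem b).2 hb) ⟨has, hsb⟩)
  have hiff : ∀ s : ℝ, v + s • w ∈ prolongable A w ↔
      v + s • w ∈ A ∧ ∃ u, s < u ∧ v + u • w ∈ A := by
    intro s
    refine and_congr_right fun _ => ⟨?_, ?_⟩
    · rintro ⟨ε, hε, hm⟩
      refine ⟨s + ε, by linarith, ?_⟩
      rwa [add_smul, ← add_assoc]
    · rintro ⟨u, hu, hm⟩
      refine ⟨u - s, by linarith, ?_⟩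
      rwa [add_assoc, ← add_smul, add_sub_cancel]
  by_cases ht : v + t • w ∈ prolongable A w
  · obtain ⟨htA, u, hu, huA⟩ := (hiff t).1 ht
    filter_upwards [Ioo_mem_nhdsGT hu] with s hs
    rw [charFn_of_mem ht, charFn_of_mem ((hiff s).2 ⟨hseg htA huA hs.1.le hs.2.le, u, hs.2, huA⟩)]
  · by_cases htA : v + t • w ∈ A
    · filter_upwards [self_mem_nhdsWithin] with s hs
      rw [charFn_of_notMem ht, charFn_of_notMem fun h => ht ((hiff t).2 ⟨htA, s, hs, h.1⟩)]
    · have hc : Continuous fun s : ℝ => v + s • w := by fun_prop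
      filter_upwards [nhdsWithin_le_nhds
        ((hcl.isOpen_compl.preimage hc).mem_nhds (show t ∈ _ from htA))] with s hs
      rw [charFn_of_notMem ht, charFn_of_notMem fun h => hs h.1]

end ConeOver

section Faces

variable {d : ℕ} {p f : Set (Fin d → ℝ)}

theorem IsFaceOf.subset (hf : IsFaceOf p f) : f ⊆ p := by
  obtain ⟨-, ℓ, rfl⟩ := hf
  exact fun x hx => hx.1

theorem IsFaceOf.convex (hp : Convex ℝ p) (hf : IsFaceOf p f) : Convex ℝ f := by
  obtain ⟨-, ℓ, rfl⟩ := hf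
  rintro x ⟨hx, hxm⟩ y ⟨hy, hym⟩ a b ha hb hab
  refine ⟨hp hx hy ha hb hab, fun u hu => ?_⟩
  have : ℓ u = a * ℓ u + b * ℓ u := by rw [← add_mul, hab, one_mul]
  rw [this, map_add, map_smul, map_smul, smul_eq_mul, smul_eq_mul]
  exact add_le_add (mul_le_mul_of_nonneg_left (hxm u hu) ha)
    (mul_le_mul_of_nonneg_left (hym u hu) hb)

theorem IsFaceOf.subset_of_mem_intrinsicInterior (hp : Convex ℝ p) (hf : IsFaceOf p f)
    {g : Set (Fin d → ℝ)} (hg : IsFaceOf p g) {x : Fin d → ℝ} (hx : x ∈ intrinsicInterior ℝ f)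
    (hxg : x ∈ g) : f ⊆ g := by
  intro y hy
  obtain ⟨ε, hε, hm⟩ :=
    ((mem_intrinsicInterior_iff_forall_prolong (hf.convex hp)).1 hx).2 y hy
  obtain ⟨-, ℓ, rfl⟩ := hg
  refine ⟨hf.subset hy, fun u hu => (hxg.2 u hu).trans ?_⟩
  have := hxg.2 _ (hf.subset hm)
  simp only [map_add, map_smul, map_sub, smul_eq_mul] at this
  by_contra! hlt
  nlinarith [mul_pos hε (sub_pos.2 hlt)]

/-- Exposed faces of a face of a polytope are faces of the polytope. -/
theorem IsFaceOf.exists_isFaceOf_lt {s : Finset (Fin d → ℝ)}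
    (hf : IsFaceOf (convexHull ℝ (s : Set (Fin d → ℝ))) f) {x y : Fin d → ℝ} (hx : x ∈ f)
    (hy : y ∈ f) (ℓ : (Fin d → ℝ) →ₗ[ℝ] ℝ) (hmax : ∀ u ∈ f, ℓ u ≤ ℓ x) (hlt : ℓ y < ℓ x) :
    ∃ g, IsFaceOf (convexHull ℝ (s : Set (Fin d → ℝ))) g ∧ x ∈ g ∧ g ⊆ f ∧ y ∉ g := by
  obtain ⟨-, ℓ₀, rfl⟩ := hf
  set P := convexHull ℝ (s : Set (Fin d → ℝ))
  have hsP : ∀ a ∈ s, a ∈ P := fun a ha => subset_convexHull ℝ _ ha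
  have hN : ∀ a ∈ s, ∀ᶠ N : ℝ in Filter.atTop, N * ℓ₀ a + ℓ a ≤ N * ℓ₀ x + ℓ x := by
    intro a ha
    rcases (hx.2 a (hsP a ha)).eq_or_lt with h | h
    · refine Filter.Eventually.of_forall fun N => ?_
      have := hmax a ⟨hsP a ha, fun u hu => h ▸ hx.2 u hu⟩
      rw [h]
      linarith
    · filter_upwards [Filter.eventually_ge_atTop ((ℓ a - ℓ x) / (ℓ₀ x - ℓ₀ a))] with N hN
      rw [div_le_iff₀ (sub_pos.2 h)] at hN
      linarith
  obtain ⟨N, hN, hN0⟩ := (((Finset.eventually_all s).2 hN).and (Filter.eventually_ge_atTop 0)).exists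
  have hP : ∀ m : (Fin d → ℝ) →ₗ[ℝ] ℝ, (∀ a ∈ s, m a ≤ m x) → ∀ u ∈ P, m u ≤ m x := by
    intro m hm u hu
    have : P ⊆ {u | m u ≤ m x} :=
      convexHull_min (fun a ha => hm a ha) (convex_halfSpace_le m.isLinear _)
    exact this hu
  have hN1 := hP ((N + 1) • ℓ₀ + ℓ) fun a ha => by
    simp only [LinearMap.add_apply, LinearMap.smul_apply, smul_eq_mul]
    linarith [hN a ha, hx.2 a (hsP a ha)]
  have hN2 := hP (N • ℓ₀ + ℓ) fun a ha => by
    simpa only [LinearMap.add_apply, LinearMap.smul_apply, smul_eq_mul] using hN a ha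
  refine ⟨{u ∈ P | ∀ q ∈ P, ((N + 1) • ℓ₀ + ℓ) q ≤ ((N + 1) • ℓ₀ + ℓ) u},
    ⟨⟨x, hx.1, hN1⟩, _, rfl⟩, ⟨hx.1, hN1⟩, ?_, ?_⟩
  · rintro u ⟨hu, hum⟩
    refine ⟨hu, fun q hq => (hx.2 q hq).trans ?_⟩
    have h1 := hum x hx.1
    have h2 := hN2 u hu
    simp only [LinearMap.add_apply, LinearMap.smul_apply, smul_eq_mul] at h1 h2
    linarith
  · rintro ⟨-, hym⟩
    have h1 := hym x hx.1
    have h2 := hx.2 y hy.1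
    simp only [LinearMap.add_apply, LinearMap.smul_apply, smul_eq_mul] at h1
    nlinarith

/-- Every point of a polytope lies in the relative interior of a face. -/
theorem exists_face_mem_intrinsicInterior {s : Finset (Fin d → ℝ)}
    {Fs : Finset (Set (Fin d → ℝ))}
    (hFs : ∀ f, f ∈ Fs ↔ IsFaceOf (convexHull ℝ (s : Set (Fin d → ℝ))) f)
    {x : Fin d → ℝ} (hx : x ∈ convexHull ℝ (s : Set (Fin d → ℝ))) :
    ∃ f ∈ Fs, x ∈ intrinsicInterior ℝ f := by
  have hne : (Fs.filter fun f => x ∈ f).Nonempty := by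
    refine ⟨convexHull ℝ (s : Set (Fin d → ℝ)), Finset.mem_filter.2 ⟨(hFs _).2 ?_, hx⟩⟩
    exact ⟨⟨x, hx⟩, 0, by simp⟩
  obtain ⟨f, hf⟩ := Finset.exists_minimal hne
  obtain ⟨hfF, hxf⟩ := Finset.mem_filter.1 hf.prop
  refine ⟨f, hfF, ?_⟩
  by_contra hxi
  have hface := (hFs f).1 hfF
  obtain ⟨ℓ, hℓ, y, hy, hlt⟩ :=
    exists_supporting_of_notMem_intrinsicInterior (hface.convex (convex_convexHull ℝ _)) hxf hxi
  obtain ⟨g, hg, hxg, hgf, hyg⟩ := hface.exists_isFaceOf_lt hxf hy ℓ hℓ hlt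
  exact hyg (hf.le_of_le (Finset.mem_filter.2 ⟨(hFs g).2 hg, hxg⟩) hgf hy)

theorem mem_affTangentCone_iff (hp : Convex ℝ p) (hfp : f ⊆ p) (hf : Convex ℝ f)
    {x z : Fin d → ℝ} (hx : x ∈ intrinsicInterior ℝ f) :
    z ∈ affTangentCone p f ↔ ∃ ε : ℝ, 0 < ε ∧ x + ε • (z - x) ∈ p := by
  constructor
  · rintro ⟨x', hx', y, hy, t, ht, rfl⟩
    have hx'p := hfp (intrinsicInterior_subset hx')
    rcases le_or_gt t 1 with ht1 | ht1
    · refine ⟨1, one_pos, ?_⟩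
      convert hp hx'p hy (sub_nonneg.2 ht1) ht (by ring) using 1
      module
    · obtain ⟨δ, hδ, hm⟩ := ((mem_intrinsicInterior_iff_forall_prolong hf).1 hx).2 x'
        (intrinsicInterior_subset hx')
      have ht' : 0 < t - 1 := sub_pos.2 ht1
      have hD : 0 < t - 1 + δ * t := by positivity
      refine ⟨δ / (t - 1 + δ * t), by positivity, ?_⟩
      convert hp (hfp hm) hy (a := (t - 1) / (t - 1 + δ * t)) (b := δ * t / (t - 1 + δ * t))
        (by positivity) (by positivity) (by field_simp) using 1
      match_scalars <;> field_simp <;> ring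
  · rintro ⟨ε, hε, hm⟩
    refine ⟨x, hx, _, hm, ε⁻¹, by positivity, ?_⟩
    rw [add_sub_cancel_left, inv_smul_smul₀ hε.ne', add_sub_cancel]

end Faces

/-- Brianchon-Gram decomposition: the characteristic function of a polytope `p`
(the convex hull of a finite set `s` in `ℝ^d`) is the sum, over the set of all
faces `f` of `p`, of `(-1)^(dim f)` times the characteristic function of the
affine tangent cone of `p` at `f`. -/
theorem brianchon_gram {d : ℕ} (s : Finset (Fin d → ℝ))
    (Fs : Finset (Set (Fin d → ℝ)))
    (hFs : ∀ f, f ∈ Fs ↔ IsFaceOf (convexHull ℝ (↑s : Set (Fin d → ℝ))) f)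
    (z : Fin d → ℝ) :
    charFn (convexHull ℝ (↑s : Set (Fin d → ℝ))) z =
      ∑ f ∈ Fs,
        (-1 : ℝ) ^ (Module.finrank ℝ (vectorSpan ℝ f)) *
          charFn (affTangentCone (convexHull ℝ (↑s : Set (Fin d → ℝ))) f) z := by
  set p := convexHull ℝ (s : Set (Fin d → ℝ))
  have hp : Convex ℝ p := convex_convexHull ℝ _
  rcases p.eq_empty_or_nonempty with he | hne
  · rw [charFn_of_notMem (by simp [he]), Finset.sum_eq_zero]
    intro f hf
    have hface := (hFs f).1 hf
    exact absurd (hface.1.mono hface.subset) (by simp [he])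
  have hconvf : ∀ f ∈ Fs, Convex ℝ f := fun f hf => ((hFs f).1 hf).convex hp
  have hsub : ∀ f ∈ Fs, f ⊆ p := fun f hf => ((hFs f).1 hf).subset
  have hri : ∀ f ∈ Fs, (intrinsicInterior ℝ f).Nonempty := fun f hf =>
    Set.Nonempty.intrinsicInterior (hconvf f hf) ((hFs f).1 hf).1
  let A : Option (Set (Fin d → ℝ)) → Set ((Fin d → ℝ) × ℝ) :=
    fun o => o.elim {0} fun f => coneOver (intrinsicInterior ℝ f)
  let c : Option (Set (Fin d → ℝ)) → ℝ :=
    fun o => o.elim (charFn p z) fun f => charFn (affTangentCone p f) z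
  have hg : ∀ v, ∑ i ∈ Finset.insertNone Fs, c i * charFn (A i) v =
      charFn (prolongable (closedConeOver p) (z, (1 : ℝ))) v := by
    intro v
    have hsum : ∑ i ∈ Finset.insertNone Fs, c i * charFn (A i) v =
        charFn p z * charFn {0} v + ∑ f ∈ Fs,
          charFn (affTangentCone p f) z * charFn (coneOver (intrinsicInterior ℝ f)) v :=
      Finset.sum_insertNone _ _
    rw [hsum]
    by_cases hv : v ∈ closedConeOver p
    · obtain ⟨y, r⟩ := v
      obtain ⟨hr, x, hx, rfl : y = r • x⟩ := hv
      rcases hr.eq_or_lt with hr | (hr : 0 < r)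
      · obtain rfl : 0 = r := hr
        rw [zero_smul, Finset.sum_eq_zero, add_zero,
          charFn_of_mem (s := {0}) (Set.mem_singleton_iff.2 Prod.mk_zero_zero), mul_one]
        · exact if_congr (zero_mem_prolongable_closedConeOver hne).symm rfl rfl
        · intro f _
          rw [charFn_of_notMem (s := coneOver (intrinsicInterior ℝ f)) (fun h => lt_irrefl _ h.1),
            mul_zero]
      · obtain ⟨f, hf, hxf⟩ := exists_face_mem_intrinsicInterior hFs hx
        have h0 : (r • x, r) ∉ ({0} : Set ((Fin d → ℝ) × ℝ)) := fun h =>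
          hr.ne' (congrArg Prod.snd h)
        rw [charFn_of_notMem h0, mul_zero, zero_add, Finset.sum_eq_single_of_mem f hf,
          charFn_of_mem (s := coneOver (intrinsicInterior ℝ f)) (x := (r • x, r))
            ⟨hr, x, hxf, rfl⟩, mul_one]
        · exact if_congr ((mem_affTangentCone_iff hp (hsub f hf) (hconvf f hf) hxf).trans
            (smul_mem_prolongable_closedConeOver hp hx hr).symm) rfl rfl
        · intro g hgF hgf
          rw [charFn_of_notMem (s := coneOver (intrinsicInterior ℝ g)), mul_zero]
          rintro ⟨-, y, hy, hxy⟩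
          obtain rfl : x = y := smul_right_injective _ hr.ne' hxy
          have hf' := (hFs f).1 hf
          have hg' := (hFs g).1 hgF
          exact hgf ((hg'.subset_of_mem_intrinsicInterior hp hf' hy
            (intrinsicInterior_subset hxf)).antisymm
            (hf'.subset_of_mem_intrinsicInterior hp hg' hxf (intrinsicInterior_subset hy)))
    · have h0 : v ∉ ({0} : Set ((Fin d → ℝ) × ℝ)) := by
        rintro rfl
        obtain ⟨x, hx⟩ := hne
        exact hv ⟨le_rfl, x, hx, by simp⟩
      rw [charFn_of_notMem fun h : v ∈ prolongable _ _ => hv h.1, charFn_of_notMem h0, mul_zero,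
        zero_add, Finset.sum_eq_zero]
      · intro f hf
        rw [charFn_of_notMem (s := coneOver (intrinsicInterior ℝ f)), mul_zero]
        rintro ⟨hr, x, hx, hy⟩
        exact hv ⟨hr.le, x, hsub f hf (intrinsicInterior_subset hx), hy⟩
  have hclosed : IsClosed (closedConeOver p) :=
    isClosed_closedConeOver (s.finite_toSet.isCompact_convexHull (𝕜 := ℝ))
  have hw : ((z, 1) : (Fin d → ℝ) × ℝ) ≠ 0 := fun h => one_ne_zero (congrArg Prod.snd h)
  have key := sum_eulerChar_eq_zero_of_lines hw
    (fun I c A h1 h2 h3 h4 => sum_eulerChar_eq_zero I c A h1 h2 h3 h4)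
    (Finset.insertNone Fs) c A ?_ ?_ ?_ ?_ ?_
  · have hsum : ∑ i ∈ Finset.insertNone Fs,
        c i * (-1 : ℝ) ^ Module.finrank ℝ (vectorSpan ℝ (A i)) =
        charFn p z * (-1 : ℝ) ^ Module.finrank ℝ (vectorSpan ℝ ({0} : Set ((Fin d → ℝ) × ℝ))) +
        ∑ f ∈ Fs, charFn (affTangentCone p f) z *
          (-1 : ℝ) ^ Module.finrank ℝ (vectorSpan ℝ (coneOver (intrinsicInterior ℝ f))) :=
      Finset.sum_insertNone _ _
    rw [hsum, vectorSpan_singleton, finrank_bot, pow_zero, mul_one] at key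
    rw [eq_neg_of_add_eq_zero_left key, ← Finset.sum_neg_distrib]
    refine Finset.sum_congr rfl fun f hf => ?_
    rw [finrank_vectorSpan_coneOver (hri f hf), vectorSpan_intrinsicInterior (hconvf f hf),
      pow_succ]
    ring
  · rintro (_ | f) hf
    · exact convex_singleton 0
    · exact convex_coneOver (convex_intrinsicInterior (hconvf f (Finset.some_mem_insertNone.1 hf)))
  · rintro (_ | f) hf
    · rintro _ rfl _ rfl
      exact ⟨1, one_pos, by simp [A]⟩
    · exact isRelOpen_coneOver
        (convex_intrinsicInterior (hconvf f (Finset.some_mem_insertNone.1 hf)))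
        (isRelOpen_intrinsicInterior (hconvf f (Finset.some_mem_insertNone.1 hf)))
  · rintro (_ | f) hf
    · exact Set.singleton_nonempty 0
    · obtain ⟨x, hx⟩ := hri f (Finset.some_mem_insertNone.1 hf)
      exact ⟨(x, 1), one_pos, x, hx, (one_smul ℝ x).symm⟩
  · intro v t
    simp only [hg]
    exact eventually_charFn_prolongable_eq (convex_closedConeOver hp) hclosed v _ t
  · intro v
    filter_upwards [eventually_atBot_notMem_closedConeOver (A := p) z v] with t ht
    rw [hg, charFn_of_notMem fun h => ht h.1]

end AC
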